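/- arXiv:0808.3431 — 2 statements merged into one kernel-verified Lean document; each statement's English description precedes it below -/
import Mathlib

section
/- Let v > 0, k_x ∈ [0,1], and let U be a random variable whose law is the mixture k_x·Uniform[0, 2v] + (1 − k_x)·δ₀, and set X₀ = g(U). Then for every nonnegative random variable Y, independent of X₀, with E[Y] ≤ b ≤ 2v, one has Pr{ X₀ ≥ g(Y) } ≥ k_x·(1 − E[Y]/(2v)) ≥ k_x·(1 − b/(2v)). -/
open MeasureTheory ProbabilityTheory Set

/-- The mixture law `k·Uniform[0,t] + (1−k)·δ₀` on `ℝ`. -/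
noncomputable def unifMix (k t : ℝ) : Measure ℝ :=
  ENNReal.ofReal k • ((ENNReal.ofReal t)⁻¹ • volume.restrict (Icc 0 t)) +
    ENNReal.ofReal (1 - k) • Measure.dirac 0

/-- The mixture law puts no mass on the negative half-line. -/
theorem unifMix_Iio_zero (k t : ℝ) : unifMix k t (Iio 0) = 0 := by
  have h : Iio (0 : ℝ) ∩ Icc 0 t = ∅ := by
    ext x
    simp only [mem_inter_iff, mem_Iio, mem_Icc, mem_empty_iff_false, iff_false]
    intro hx
    linarith [hx.1, hx.2.1]
  simp [unifMix, Measure.restrict_apply measurableSet_Iio, h]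

/-- Lower bound for the upper tail of the mixture law. -/
theorem ofReal_le_unifMix_Ici {k t y : ℝ} (hk : 0 ≤ k) (ht : 0 < t) (hy : 0 ≤ y) :
    ENNReal.ofReal (k * (1 - y / t)) ≤ unifMix k t (Ici y) := by
  have h : Ici y ∩ Icc 0 t = Icc y t := by
    ext x
    simp only [mem_inter_iff, mem_Ici, mem_Icc]
    exact ⟨fun hx => ⟨hx.1, hx.2.2⟩, fun hx => ⟨hx.1, hy.trans hx.1, hx.2⟩⟩
  have hkt : k * (1 - y / t) = k * (t⁻¹ * (t - y)) := by
    field_simp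
  simp only [unifMix, Measure.coe_add, Measure.coe_smul, Pi.add_apply, Pi.smul_apply, smul_eq_mul,
    Measure.restrict_apply measurableSet_Ici, h, Real.volume_Icc]
  rw [hkt, ENNReal.ofReal_mul hk, ENNReal.ofReal_mul (inv_nonneg.2 ht.le),
    ENNReal.ofReal_inv_of_pos ht]
  exact le_self_add

/-- The integral of a real function is at most the lower integral of its positive part. -/
theorem integral_le_toReal_lintegral_ofReal {α : Type*} [MeasurableSpace α] {μ : Measure α}
    {f : α → ℝ} (hf : Integrable f μ) :
    ∫ a, f a ∂μ ≤ (∫⁻ a, ENNReal.ofReal (f a) ∂μ).toReal := by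
  rw [integral_eq_lintegral_pos_part_sub_lintegral_neg_part hf]
  exact sub_le_self _ ENNReal.toReal_nonneg

/-- For independent `X` and `Y`, the probability of `G Y ≤ X` is obtained by conditioning on `Y`. -/
theorem measure_le_eq_lintegral_of_indepFun {Ω : Type*} [MeasurableSpace Ω] {P : Measure Ω}
    [IsProbabilityMeasure P] {X Y : Ω → ℝ} {G : ℝ → ℝ} (hG : Measurable G)
    (hX : AEMeasurable X P) (hY : Measurable Y) (hindep : IndepFun X Y P) :
    P {ω | G (Y ω) ≤ X ω} = ∫⁻ ω, P {ω' | G (Y ω) ≤ X ω'} ∂P := by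
  have hS : MeasurableSet {p : ℝ × ℝ | G p.2 ≤ p.1} :=
    measurableSet_le (hG.comp measurable_snd) measurable_fst
  have hmap := (indepFun_iff_map_prod_eq_prod_map_map hX hY.aemeasurable).1 hindep
  have h₁ : P {ω | G (Y ω) ≤ X ω} =
      P.map (fun ω => (X ω, Y ω)) {p : ℝ × ℝ | G p.2 ≤ p.1} := by
    rw [Measure.map_apply_of_aemeasurable (hX.prodMk hY.aemeasurable) hS]
    rfl
  have : IsProbabilityMeasure (P.map X) := Measure.isProbabilityMeasure_map hX
  have : IsProbabilityMeasure (P.map Y) := Measure.isProbabilityMeasure_map hY.aemeasurable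
  rw [h₁, hmap, Measure.prod_apply_symm hS,
    lintegral_map (measurable_measure_prodMk_right hS) hY]
  refine lintegral_congr fun ω => ?_
  rw [Measure.map_apply_of_aemeasurable hX (measurable_prodMk_right hS)]
  rfl

/-- if `U` has law `k_x·Uniform[0,2v] + (1−k_x)·δ₀` and `X₀ = g(U)`, then
for every nonnegative `Y` independent of `X₀` with `E[Y] ≤ b ≤ 2v`,
`Pr{X₀ ≥ g(Y)} ≥ k_x(1 − E[Y]/(2v)) ≥ k_x(1 − b/(2v))`. -/
theorem stmt9
    {Ω : Type*} [MeasurableSpace Ω] (P : Measure Ω) [IsProbabilityMeasure P]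
    (g : ℝ → ℝ) (hg_mono : MonotoneOn g (Ici 0))
    (hg_nonneg : ∀ y, 0 ≤ y → 0 ≤ g y) (hg0 : g 0 = 0)
    (hg_leftcont : ∀ y : ℝ, 0 < y → Filter.Tendsto g (nhdsWithin y (Iio y)) (nhds (g y)))
    (v : ℝ) (hv : 0 < v) (kx : ℝ) (hkx : kx ∈ Icc (0 : ℝ) 1)
    (U : Ω → ℝ) (hU : Measurable U) (hUlaw : P.map U = unifMix kx (2 * v))
    (X₀ : Ω → ℝ) (hX₀ : X₀ = fun ω => g (U ω))
    (b : ℝ) (hb : 0 < b) (hb2v : b ≤ 2 * v)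
    (Y : Ω → ℝ) (hY : Measurable Y) (hYnonneg : ∀ ω, 0 ≤ Y ω)
    (hYint : Integrable Y P) (hEY : (∫ ω, Y ω ∂P) ≤ b)
    (hindep : IndepFun X₀ Y P) :
    kx * (1 - b / (2 * v)) ≤ kx * (1 - (∫ ω, Y ω ∂P) / (2 * v)) ∧
    kx * (1 - (∫ ω, Y ω ∂P) / (2 * v)) ≤ (P {ω | g (Y ω) ≤ X₀ ω}).toReal := by
  have ht : 0 < 2 * v := by linarith
  refine ⟨by have := hkx.1; gcongr, ?_⟩
  have hU0 : ∀ᵐ ω ∂P, 0 ≤ U ω := by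
    have h : P (U ⁻¹' Iio 0) = 0 := by
      rw [← Measure.map_apply hU measurableSet_Iio, hUlaw, unifMix_Iio_zero]
    filter_upwards [measure_eq_zero_iff_ae_notMem.1 h] with ω hω
    exact not_lt.1 hω
  have hG : Monotone fun y => g (max y 0) := fun x y hxy =>
    hg_mono (le_max_right x 0) (le_max_right y 0) (max_le_max_right 0 hxy)
  have hXm : AEMeasurable X₀ P := by
    refine ⟨fun ω => g (max (U ω) 0), hG.measurable.comp hU, ?_⟩
    filter_upwards [hU0] with ω hω
    simp [hX₀, max_eq_left hω]
  have hbound : ∀ ω, ENNReal.ofReal (kx * (1 - Y ω / (2 * v))) ≤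
      P {ω' | g (max (Y ω) 0) ≤ X₀ ω'} := fun ω => by
    refine (ofReal_le_unifMix_Ici hkx.1 ht (hYnonneg ω)).trans ?_
    rw [← hUlaw, Measure.map_apply hU measurableSet_Ici]
    refine measure_mono fun ω' hω' => ?_
    have hω' : Y ω ≤ U ω' := hω'
    have h := hg_mono (hYnonneg ω) ((hYnonneg ω).trans hω') hω'
    simpa [hX₀, max_eq_left (hYnonneg ω)] using h
  have hprob : P {ω | g (Y ω) ≤ X₀ ω} = ∫⁻ ω, P {ω' | g (max (Y ω) 0) ≤ X₀ ω'} ∂P := by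
    rw [← measure_le_eq_lintegral_of_indepFun hG.measurable hXm hY hindep]
    simp only [max_eq_left (hYnonneg _)]
  have hint : Integrable (fun ω => kx * (1 - Y ω / (2 * v))) P :=
    ((integrable_const 1).sub (hYint.div_const _)).const_mul _
  have hval : ∫ ω, kx * (1 - Y ω / (2 * v)) ∂P = kx * (1 - (∫ ω, Y ω ∂P) / (2 * v)) := by
    rw [integral_const_mul, integral_sub (integrable_const 1) (hYint.div_const _),
      integral_div]
    simp
  rw [← hval]
  refine (integral_le_toReal_lintegral_ofReal hint).trans ?_
  refine ENNReal.toReal_mono (measure_ne_top P _) ?_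
  rw [hprob]
  exact lintegral_mono hbound
end

section
/- Assume in addition that g is strictly increasing, continuous and unbounded on [max{b/2, g⁻¹(a)/2}, ∞). Then the system of three equations k_x·(1 − b/(2v)) = 1 − k_y·(1 − a/g(2v)), k_x = 2va / ∫₀^{2v} g(y) dy, k_y = g(2v)·b / ∫₀^{g(2v)} g⁻¹(x) dx has exactly one solution (v, k_x, k_y) with k_x, k_y ∈ [0,1] and v ∈ [max{b/2, g⁻¹(a)/2}, ∞). Moreover this solution is determined as follows: let v₀ be the unique value with a·b = (g(2v₀) − a)(2v₀ − b) and set S(v₀) = ∫₀^{2v₀} g(y) dy − 2v₀·a; if S(v₀) < 0 then k_x = 1, v is the unique solution of ∫₀^{2v} g(y) dy = 2va, and k_y = b·g(2v)/(2v(g(2v) − a)); if S(v₀) = 0 then v = v₀ and k_x = k_y = 1; if S(v₀) > 0 then k_y = 1, v is the unique solution of ∫₀^{2v} g(y) dy = g(2v)(2v − b), and k_x = 2va/(g(2v)(2v − b)). -/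
open MeasureTheory Set

/-- The generalized inverse of a monotone function is bounded by any point of the superlevel set. -/
theorem sInf_superlevel_le {g : ℝ → ℝ} {x y : ℝ} (hy : 0 ≤ y) (hxy : x ≤ g y) :
    sInf {y : ℝ | 0 ≤ y ∧ x ≤ g y} ≤ y :=
  csInf_le ⟨0, fun _ h => h.1⟩ ⟨hy, hxy⟩

theorem le_of_sInf_superlevel_lt {g : ℝ → ℝ} (hg : MonotoneOn g (Ici 0)) {x y z : ℝ} (hz : 0 ≤ z)
    (hxz : x ≤ g z) (hy : sInf {y : ℝ | 0 ≤ y ∧ x ≤ g y} < y) : x ≤ g y := by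
  obtain ⟨u, ⟨hu0, hu⟩, huy⟩ := exists_lt_of_csInf_lt
    (s := {y : ℝ | 0 ≤ y ∧ x ≤ g y}) ⟨z, hz, hxz⟩ hy
  exact hu.trans (hg hu0 (hu0.trans huy.le) huy.le)

/-- Young's identity for a monotone function and its generalized inverse. -/
theorem integral_sInf_superlevel {g : ℝ → ℝ} (hg : MonotoneOn g (Ici 0))
    (hg_nonneg : ∀ y, 0 ≤ y → 0 ≤ g y) {w : ℝ} (hw : 0 ≤ w) :
    ∫ x in (0 : ℝ)..(g w), sInf {y : ℝ | 0 ≤ y ∧ x ≤ g y} =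
      w * g w - ∫ y in (0 : ℝ)..w, g y := by
  have hgw := hg_nonneg w hw
  have hg_int : IntervalIntegrable g volume 0 w := by
    apply MonotoneOn.intervalIntegrable
    rw [uIcc_of_le hw]
    exact hg.mono fun x hx => hx.1
  have hg_int' : IntervalIntegrable (fun x => sInf {y : ℝ | 0 ≤ y ∧ x ≤ g y}) volume 0 (g w) := by
    apply MonotoneOn.intervalIntegrable
    rw [uIcc_of_le hgw]
    intro x₁ _ x₂ hx₂ h
    exact csInf_le_csInf ⟨0, fun _ h => h.1⟩ ⟨w, hw, hx₂.2⟩ fun y hy => ⟨hy.1, h.trans hy.2⟩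
  have hlayer : ∫ y in (0 : ℝ)..w, g y =
      ∫ x in (0 : ℝ)..(g w), (w - sInf {y : ℝ | 0 ≤ y ∧ x ≤ g y}) := by
    rw [intervalIntegral.integral_of_le hw, intervalIntegral.integral_of_le hgw,
      Integrable.integral_eq_integral_Ioc_meas_le (M := g w)
        ((intervalIntegrable_iff_integrableOn_Ioc_of_le hw).1 hg_int)]
    · refine setIntegral_congr_fun measurableSet_Ioc fun x hx => ?_
      have h0 : 0 ≤ sInf {y : ℝ | 0 ≤ y ∧ x ≤ g y} := Real.sInf_nonneg fun _ h => h.1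
      have h1 : sInf {y : ℝ | 0 ≤ y ∧ x ≤ g y} ≤ w := sInf_superlevel_le hw hx.2
      have hae : {y | x ≤ g y} =ᵐ[volume.restrict (Ioc 0 w)]
          Ioc (sInf {y : ℝ | 0 ≤ y ∧ x ≤ g y}) w := by
        have hne : ∀ᵐ y ∂(volume.restrict (Ioc 0 w)),
            y ≠ sInf {y : ℝ | 0 ≤ y ∧ x ≤ g y} :=
          ae_restrict_of_ae (Measure.ae_ne volume _)
        filter_upwards [hne, ae_restrict_mem measurableSet_Ioc] with y hy hy'
        refine propext ⟨fun h => ⟨?_, hy'.2⟩, fun h => le_of_sInf_superlevel_lt hg hw hx.2 h.1⟩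
        exact lt_of_le_of_ne (sInf_superlevel_le hy'.1.le h) hy.symm
      have hset : Ioc (sInf {y : ℝ | 0 ≤ y ∧ x ≤ g y}) w ∩ Ioc 0 w =
          Ioc (sInf {y : ℝ | 0 ≤ y ∧ x ≤ g y}) w :=
        inter_eq_left.2 (Ioc_subset_Ioc_left h0)
      change (volume.restrict (Ioc 0 w)).real {y | x ≤ g y} = _
      rw [measureReal_congr hae, measureReal_restrict_apply measurableSet_Ioc, hset,
        Real.volume_real_Ioc_of_le h1]
    · filter_upwards [ae_restrict_mem measurableSet_Ioc] with y hy using hg_nonneg y hy.1.le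
    · filter_upwards [ae_restrict_mem measurableSet_Ioc] with y hy using hg hy.1.le hw hy.2
  rw [hlayer, intervalIntegral.integral_sub intervalIntegrable_const hg_int',
    intervalIntegral.integral_const, smul_eq_mul]
  ring

/-- Strict rectangle bounds for the integral of a continuous strictly increasing function. -/
theorem integral_bounds_of_strictMonoOn {g : ℝ → ℝ} {c d : ℝ} (hcd : c < d)
    (hg : StrictMonoOn g (Icc c d)) (hc : ContinuousOn g (Icc c d)) :
    (d - c) * g c < ∫ y in c..d, g y ∧ ∫ y in c..d, g y < (d - c) * g d := by
  have hcm : c ∈ Icc c d := ⟨le_rfl, hcd.le⟩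
  have hdm : d ∈ Icc c d := ⟨hcd.le, le_rfl⟩
  have hl := intervalIntegral.integral_lt_integral_of_continuousOn_of_le_of_exists_lt hcd
    (continuousOn_const (c := g c)) hc (fun x hx => hg.monotoneOn hcm ⟨hx.1.le, hx.2⟩ hx.1.le)
    ⟨d, hdm, hg hcm hdm hcd⟩
  have hr := intervalIntegral.integral_lt_integral_of_continuousOn_of_le_of_exists_lt hcd
    hc (continuousOn_const (c := g d)) (fun x hx => hg.monotoneOn ⟨hx.1.le, hx.2⟩ hdm hx.2)
    ⟨c, hcm, hg hcm hdm hcd⟩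
  simpa using And.intro hl hr

/-- Under the power constraints, the indifference equation says that one of them is tight. -/
theorem equilibrium_equation_iff {a b w γ G H : ℝ} (hw : 0 < w) (hγ : 0 < γ) (hG : 0 < G)
    (hH : 0 < H) (hGH : G + H = w * γ) :
    w * a / G * (1 - b / w) = 1 - γ * b / H * (1 - a / γ) ↔
      (G - w * a) * (H - γ * b) = 0 := by
  have e1 : w * a / G * (1 - b / w) = a * (w - b) / G := by field_simp
  have e2 : γ * b / H * (1 - a / γ) = b * (γ - a) / H := by field_simp
  rw [e1, e2, eq_sub_iff_add_eq, div_add_div _ _ hG.ne' hH.ne', div_eq_one_iff_eq (by positivity)]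
  constructor <;> intro h <;> linear_combination (-1 : ℝ) * h - a * b * hGH

/-- if `g` is strictly increasing, continuous and unbounded on
`[m, ∞)` with `m = max{b/2, g⁻¹(a)/2}`, then the system of three equilibrium
equations has exactly one solution `(v, k_x, k_y)` with `k_x, k_y ∈ [0,1]` and
`v ∈ [m, ∞)`, and this solution is determined by the sign of
`S(v₀) = ∫₀^{2v₀} g − 2v₀·a`, where `v₀` is the unique value with
`a·b = (g(2v₀) − a)(2v₀ − b)`. -/
theorem stmt12
    (g : ℝ → ℝ) (hg_mono : MonotoneOn g (Ici 0))
    (hg_nonneg : ∀ y, 0 ≤ y → 0 ≤ g y) (hg0 : g 0 = 0)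
    (hg_leftcont : ∀ y : ℝ, 0 < y → Filter.Tendsto g (nhdsWithin y (Iio y)) (nhds (g y)))
    (ginv : ℝ → ℝ) (hginv : ∀ x, ginv x = sInf {y : ℝ | 0 ≤ y ∧ x ≤ g y})
    (a b : ℝ) (ha : 0 < a) (hb : 0 < b)
    (m : ℝ) (hm : m = max (b / 2) (ginv a / 2))
    -- `g` is strictly increasing, continuous and unbounded on `[m, ∞)`
    (hg_strict : StrictMonoOn g (Ici m)) (hg_cont : ContinuousOn g (Ici m))
    (hg_unbdd : ∀ M : ℝ, ∃ y, m ≤ y ∧ M < g y)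
    -- the system of three equations, with variables constrained as in the statement
    (Sys : ℝ → ℝ → ℝ → Prop)
    (hSys : ∀ v kx ky, Sys v kx ky ↔
      (m ≤ v ∧ kx ∈ Icc (0 : ℝ) 1 ∧ ky ∈ Icc (0 : ℝ) 1 ∧
        kx * (1 - b / (2 * v)) = 1 - ky * (1 - a / g (2 * v)) ∧
        kx = 2 * v * a / (∫ y in (0 : ℝ)..(2 * v), g y) ∧
        ky = g (2 * v) * b / (∫ x in (0 : ℝ)..(g (2 * v)), ginv x)))
    -- `v₀` is the unique value with `a·b = (g(2v₀) − a)(2v₀ − b)`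
    (v₀ : ℝ) (hv₀m : m ≤ v₀) (hv₀ : a * b = (g (2 * v₀) - a) * (2 * v₀ - b))
    (hv₀uniq : ∀ v, m ≤ v → a * b = (g (2 * v) - a) * (2 * v - b) → v = v₀)
    (S : ℝ) (hS : S = (∫ y in (0 : ℝ)..(2 * v₀), g y) - 2 * v₀ * a) :
    -- the system has exactly one solution
    (∃! t : ℝ × ℝ × ℝ, Sys t.1 t.2.1 t.2.2) ∧
    -- and the solution is determined as follows
    (∀ v kx ky, Sys v kx ky →
      (S < 0 →
        kx = 1 ∧
        (∫ y in (0 : ℝ)..(2 * v), g y) = 2 * v * a ∧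
        (∀ v', m ≤ v' → (∫ y in (0 : ℝ)..(2 * v'), g y) = 2 * v' * a → v' = v) ∧
        ky = b * g (2 * v) / (2 * v * (g (2 * v) - a))) ∧
      (S = 0 → v = v₀ ∧ kx = 1 ∧ ky = 1) ∧
      (0 < S →
        ky = 1 ∧
        (∫ y in (0 : ℝ)..(2 * v), g y) = g (2 * v) * (2 * v - b) ∧
        (∀ v', m ≤ v' → (∫ y in (0 : ℝ)..(2 * v'), g y) = g (2 * v') * (2 * v' - b) → v' = v) ∧
        kx = 2 * v * a / (g (2 * v) * (2 * v - b)))) := by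
  have hm0 : 0 < m := by rw [hm]; exact lt_max_of_lt_left (by linarith)
  have hmb : b ≤ 2 * m := by have := le_max_left (b / 2) (ginv a / 2); linarith
  have hma : ginv a ≤ 2 * m := by have := le_max_right (b / 2) (ginv a / 2); linarith
  have hga : ∀ w, 2 * m < w → a ≤ g w := by
    intro w hw
    obtain ⟨z, hz, haz⟩ := hg_unbdd a
    refine le_of_sInf_superlevel_lt hg_mono (hm0.le.trans hz) haz.le ?_
    rw [← hginv]
    linarith
  have hga' : ∀ w, 2 * m ≤ w → a ≤ g w := by
    intro w hw
    rcases hw.lt_or_eq with h | rfl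
    · exact hga w h
    have hc : ContinuousAt g (2 * m) := hg_cont.continuousAt (Ici_mem_nhds (by linarith))
    refine ge_of_tendsto (hc.tendsto.mono_left
      (nhdsWithin_le_nhds : nhdsWithin (2 * m) (Ioi (2 * m)) ≤ _)) ?_
    filter_upwards [self_mem_nhdsWithin] with y hy using hga y hy
  have hg_int : ∀ c d, 0 ≤ c → 0 ≤ d → IntervalIntegrable g volume c d := fun c d hc hd =>
    (hg_mono.mono fun x hx => (le_min hc hd).trans hx.1).intervalIntegrable
  have hbd : ∀ c d, m ≤ c → c < d →
      (d - c) * g c < ∫ y in c..d, g y ∧ ∫ y in c..d, g y < (d - c) * g d := fun c d hc hcd =>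
    integral_bounds_of_strictMonoOn hcd (hg_strict.mono fun x hx => hc.trans hx.1)
      (hg_cont.mono fun x hx => hc.trans hx.1)
  obtain ⟨G, hG⟩ : ∃ G : ℝ → ℝ, ∀ w, G w = ∫ y in (0 : ℝ)..w, g y := ⟨_, fun _ => rfl⟩
  have hGadd : ∀ c d, 0 ≤ c → 0 ≤ d → G d = G c + ∫ y in c..d, g y := fun c d hc hd => by
    rw [hG, hG, intervalIntegral.integral_add_adjacent_intervals (hg_int _ _ le_rfl hc)
      (hg_int _ _ hc hd)]
  have hGlo : ∀ c d, m ≤ c → c < d → (d - c) * g c < G d - G c := fun c d hc hcd => by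
    rw [hGadd c d (by linarith) (by linarith)]; linarith [(hbd c d hc hcd).1]
  have hGhi : ∀ c d, m ≤ c → c < d → G d - G c < (d - c) * g d := fun c d hc hcd => by
    rw [hGadd c d (by linarith) (by linarith)]; linarith [(hbd c d hc hcd).2]
  have hGm : 0 ≤ G m := by
    rw [hG]
    exact intervalIntegral.integral_nonneg hm0.le fun y hy => hg_nonneg y hy.1
  have hGm' : G m ≤ m * g m := by
    rw [hG]
    have := intervalIntegral.integral_mono_on hm0.le (hg_int 0 m le_rfl hm0.le)
      (intervalIntegrable_const (c := g m)) fun y hy => hg_mono hy.1 hm0.le hy.2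
    simpa using this
  have hgm := hg_nonneg m hm0.le
  have hGpos : ∀ w, m < w → 0 < G w := fun w hw => by
    have := hGlo m w le_rfl hw
    have := mul_nonneg (sub_nonneg.2 hw.le) hgm
    linarith
  have hGlt : ∀ w, m < w → G w < w * g w := fun w hw => by
    have h1 := hGhi m w le_rfl hw
    have h2 := mul_le_mul_of_nonneg_left (hg_strict (le_refl m) hw.le hw).le hm0.le
    linarith
  have hGcont : ∀ c d, m ≤ c → c ≤ d → ContinuousOn G (Icc c d) := fun c d hc hcd => by
    have h := intervalIntegral.continuousOn_primitive_interval
      ((intervalIntegrable_iff' (by simp)).1 (hg_int 0 d le_rfl (by linarith)))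
    rw [uIcc_of_le (by linarith)] at h
    refine (h.congr fun x _ => hG x).mono (Icc_subset_Icc_left (by linarith))
  have hYoung : ∀ w, 0 ≤ w → ∫ x in (0 : ℝ)..(g w), ginv x = w * g w - G w := fun w hw => by
    rw [hG, ← integral_sInf_superlevel hg_mono hg_nonneg hw]
    simp only [hginv]
  obtain ⟨s, hs⟩ : ∃ s : ℝ → ℝ, ∀ w, s w = G w - w * a := ⟨_, fun _ => rfl⟩
  obtain ⟨t, ht⟩ : ∃ t : ℝ → ℝ, ∀ w, t w = g w * (w - b) - G w := ⟨_, fun _ => rfl⟩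
  have hsmono : StrictMonoOn s (Ici (2 * m)) := fun c hc d hd hcd => by
    simp only [mem_Ici] at hc hd
    have h1 := hGlo c d (by linarith) hcd
    have h2 := mul_le_mul_of_nonneg_left (hga' c hc) (sub_nonneg.2 hcd.le)
    rw [hs, hs]
    linarith
  have htmono : StrictMonoOn t (Ici (2 * m)) := fun c hc d hd hcd => by
    simp only [mem_Ici] at hc hd
    have h1 := hGhi c d (by linarith) hcd
    have h2 : g c ≤ g d := hg_mono (show (0 : ℝ) ≤ c by linarith) (show (0 : ℝ) ≤ d by linarith)
      hcd.le
    have h3 := mul_le_mul_of_nonneg_right h2 (show 0 ≤ c - b by linarith)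
    rw [ht, ht]
    linarith
  have hscont : ∀ c d, m ≤ c → c ≤ d → ContinuousOn s (Icc c d) := fun c d hc hcd =>
    ((hGcont c d hc hcd).sub (by fun_prop : ContinuousOn (fun w => w * a) _)).congr fun x _ => hs x
  have htcont : ∀ c d, m ≤ c → c ≤ d → ContinuousOn t (Icc c d) := fun c d hc hcd =>
    (((hg_cont.mono fun x hx => hc.trans hx.1).mul
      (by fun_prop : ContinuousOn (fun w => w - b) _)).sub (hGcont c d hc hcd)).congr
      fun x _ => ht x
  have hspos : ∃ w, 2 * v₀ ≤ w ∧ 0 < s w := by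
    have h1 : g (2 * v₀) < g (2 * v₀ + 1) :=
      hg_strict (show m ≤ _ by linarith) (show m ≤ _ by linarith) (by linarith)
    have h2 := hga' (2 * v₀) (by linarith)
    have hδ : 0 < g (2 * v₀ + 1) - a := by linarith
    have hq : 0 ≤ |s (2 * v₀ + 1)| / (g (2 * v₀ + 1) - a) := by positivity
    refine ⟨2 * v₀ + 1 + (|s (2 * v₀ + 1)| / (g (2 * v₀ + 1) - a) + 1), by linarith, ?_⟩
    have h3 := hGlo (2 * v₀ + 1) (2 * v₀ + 1 + (|s (2 * v₀ + 1)| / (g (2 * v₀ + 1) - a) + 1))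
      (by linarith) (by linarith)
    have h4 : |s (2 * v₀ + 1)| / (g (2 * v₀ + 1) - a) * (g (2 * v₀ + 1) - a) =
      |s (2 * v₀ + 1)| := div_mul_cancel₀ _ hδ.ne'
    have h5 := neg_abs_le (s (2 * v₀ + 1))
    rw [hs (2 * v₀ + 1 + _)]
    have h6 := hs (2 * v₀ + 1)
    linarith
  have htpos : ∃ w, 2 * v₀ ≤ w ∧ 0 < t w := by
    set c := 2 * v₀ + 1 with hc
    obtain ⟨z, hz, hgz⟩ := hg_unbdd (g c + |t c| / (c - b))
    have hcb : 0 < c - b := by linarith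
    have hq : 0 ≤ |t c| / (c - b) := by positivity
    have hcz : c < z := by
      by_contra! h
      have : g z ≤ g c := hg_mono (show (0 : ℝ) ≤ z by linarith) (show (0 : ℝ) ≤ c by linarith) h
      linarith
    refine ⟨z, by linarith, ?_⟩
    have h1 := hGhi c z (by linarith) hcz
    have h2 : |t c| / (c - b) * (c - b) = |t c| := div_mul_cancel₀ _ hcb.ne'
    have h3 := mul_lt_mul_of_pos_right hgz hcb
    have h4 := neg_abs_le (t c)
    have h5 := ht c
    rw [ht z]
    linarith
  have hSs : S = s (2 * v₀) := by rw [hS, hs, hG]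
  have hst : s (2 * v₀) + t (2 * v₀) = 0 := by
    rw [hs, ht]
    linear_combination -hv₀
  have hSys' : ∀ v kx ky, Sys v kx ky ↔
      (m ≤ v ∧ kx = 2 * v * a / G (2 * v) ∧
        ky = g (2 * v) * b / (2 * v * g (2 * v) - G (2 * v)) ∧
        0 ≤ s (2 * v) ∧ 0 ≤ t (2 * v) ∧ s (2 * v) * t (2 * v) = 0) := by
    intro v kx ky
    rw [hSys]
    refine and_congr_right fun hv => ?_
    have hv0 : 0 < v := by linarith
    have h2v : m < 2 * v := by linarith
    have hgv : 0 < g (2 * v) := ha.trans_le (hga' _ (by linarith))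
    have hGv := hGpos _ h2v
    have hHv := sub_pos.2 (hGlt _ h2v)
    have ht' : t (2 * v) = 2 * v * g (2 * v) - G (2 * v) - g (2 * v) * b := by rw [ht]; ring
    rw [hYoung _ (by linarith), ← hG, ht', hs]
    have key := equilibrium_equation_iff (a := a) (b := b) (by linarith : 0 < 2 * v) hgv hGv hHv
      (by ring)
    constructor
    · rintro ⟨hkx, hky, he, rfl, rfl⟩
      exact ⟨rfl, rfl, sub_nonneg.2 ((div_le_one hGv).1 hkx.2),
        sub_nonneg.2 ((div_le_one hHv).1 hky.2), key.1 he⟩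
    · rintro ⟨rfl, rfl, h1, h2, h3⟩
      exact ⟨⟨by positivity, (div_le_one hGv).2 (sub_nonneg.1 h1)⟩,
        ⟨by positivity, (div_le_one hHv).2 (sub_nonneg.1 h2)⟩, key.2 h3, rfl, rfl⟩
  have hge : ∀ v, m ≤ v → 0 ≤ s (2 * v) → 0 ≤ t (2 * v) → v₀ ≤ v := by
    intro v hv h1 h2
    by_contra! h
    have h3 := hsmono (show 2 * m ≤ 2 * v by linarith) (show 2 * m ≤ 2 * v₀ by linarith)
      (by linarith)
    have h4 := htmono (show 2 * m ≤ 2 * v by linarith) (show 2 * m ≤ 2 * v₀ by linarith)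
      (by linarith)
    linarith
  have hsle : ∀ v, v₀ ≤ v → s (2 * v₀) ≤ s (2 * v) := fun v hv =>
    hsmono.monotoneOn (show 2 * m ≤ 2 * v₀ by linarith) (show 2 * m ≤ 2 * v by linarith)
      (by linarith)
  have htle : ∀ v, v₀ ≤ v → t (2 * v₀) ≤ t (2 * v) := fun v hv =>
    htmono.monotoneOn (show 2 * m ≤ 2 * v₀ by linarith) (show 2 * m ≤ 2 * v by linarith)
      (by linarith)
  have hsinj : ∀ v v', m ≤ v → m ≤ v' → s (2 * v) = s (2 * v') → v = v' := by
    intro v v' hv hv' h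
    have := hsmono.injOn (show 2 * m ≤ 2 * v by linarith) (show 2 * m ≤ 2 * v' by linarith) h
    linarith
  have htinj : ∀ v v', m ≤ v → m ≤ v' → t (2 * v) = t (2 * v') → v = v' := by
    intro v v' hv hv' h
    have := htmono.injOn (show 2 * m ≤ 2 * v by linarith) (show 2 * m ≤ 2 * v' by linarith) h
    linarith
  have hneg : S < 0 → ∀ v, m ≤ v → 0 ≤ s (2 * v) → 0 ≤ t (2 * v) → s (2 * v) * t (2 * v) = 0 →
      s (2 * v) = 0 := by
    intro hS0 v hv h1 h2 h3
    have := htle v (hge v hv h1 h2)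
    exact (mul_eq_zero.1 h3).resolve_right (by linarith)
  have hpos : 0 < S → ∀ v, m ≤ v → 0 ≤ s (2 * v) → 0 ≤ t (2 * v) → s (2 * v) * t (2 * v) = 0 →
      t (2 * v) = 0 := by
    intro hS0 v hv h1 h2 h3
    have := hsle v (hge v hv h1 h2)
    exact (mul_eq_zero.1 h3).resolve_left (by linarith)
  have hzero : S = 0 → ∀ v, m ≤ v → s (2 * v) * t (2 * v) = 0 → v = v₀ := by
    intro hS0 v hv h3
    rcases mul_eq_zero.1 h3 with h | h
    · exact hsinj v v₀ hv hv₀m (by linarith)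
    · exact htinj v v₀ hv hv₀m (by linarith)
  constructor
  · have hex : ∃ v, m ≤ v ∧ 0 ≤ s (2 * v) ∧ 0 ≤ t (2 * v) ∧ s (2 * v) * t (2 * v) = 0 := by
      rcases lt_trichotomy S 0 with h | h | h
      · obtain ⟨w, hw, hsw⟩ := hspos
        obtain ⟨u, hu, hu0⟩ := intermediate_value_Icc hw (hscont (2 * v₀) w (by linarith) hw)
          (show (0 : ℝ) ∈ Icc (s (2 * v₀)) (s w) from ⟨by linarith, hsw.le⟩)
        have h2 := htle (u / 2) (by linarith [hu.1])
        have hu2 : 2 * (u / 2) = u := by ring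
        refine ⟨u / 2, by linarith [hu.1], ?_⟩
        rw [hu2] at h2 ⊢
        exact ⟨hu0.ge, by linarith, by rw [hu0, zero_mul]⟩
      · exact ⟨v₀, hv₀m, by linarith, by linarith, by rw [← hSs, h, zero_mul]⟩
      · obtain ⟨w, hw, htw⟩ := htpos
        obtain ⟨u, hu, hu0⟩ := intermediate_value_Icc hw (htcont (2 * v₀) w (by linarith) hw)
          (show (0 : ℝ) ∈ Icc (t (2 * v₀)) (t w) from ⟨by linarith, htw.le⟩)
        have h2 := hsle (u / 2) (by linarith [hu.1])
        have hu2 : 2 * (u / 2) = u := by ring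
        refine ⟨u / 2, by linarith [hu.1], ?_⟩
        rw [hu2] at h2 ⊢
        exact ⟨by linarith, hu0.ge, by rw [hu0, mul_zero]⟩
    have huniq : ∀ v v', m ≤ v → 0 ≤ s (2 * v) → 0 ≤ t (2 * v) → s (2 * v) * t (2 * v) = 0 →
        m ≤ v' → 0 ≤ s (2 * v') → 0 ≤ t (2 * v') → s (2 * v') * t (2 * v') = 0 → v = v' := by
      intro v v' hv h1 h2 h3 hv' h1' h2' h3'
      rcases lt_trichotomy S 0 with h | h | h
      · exact hsinj v v' hv hv' ((hneg h v hv h1 h2 h3).trans (hneg h v' hv' h1' h2' h3').symm)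
      · exact (hzero h v hv h3).trans (hzero h v' hv' h3').symm
      · exact htinj v v' hv hv' ((hpos h v hv h1 h2 h3).trans (hpos h v' hv' h1' h2' h3').symm)
    obtain ⟨v, hv, h1, h2, h3⟩ := hex
    refine ⟨(v, 2 * v * a / G (2 * v), g (2 * v) * b / (2 * v * g (2 * v) - G (2 * v))),
      (hSys' _ _ _).2 ⟨hv, rfl, rfl, h1, h2, h3⟩, ?_⟩
    rintro ⟨v', kx, ky⟩ hsys
    obtain ⟨hv', hkx, hky, h1', h2', h3'⟩ := (hSys' _ _ _).1 hsys
    obtain rfl : v = v' := huniq v v' hv h1 h2 h3 hv' h1' h2' h3'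
    exact Prod.ext rfl (Prod.ext hkx hky)
  · intro v kx ky hsys
    obtain ⟨hv, hkx, hky, h1, h2, h3⟩ := (hSys' _ _ _).1 hsys
    have h2v : m < 2 * v := by linarith
    have hGv := hGpos _ h2v
    have hHv := sub_pos.2 (hGlt _ h2v)
    have hkx1 : s (2 * v) = 0 → kx = 1 := fun h => by
      rw [hs] at h
      rw [hkx, div_eq_one_iff_eq hGv.ne']
      linarith
    have hky1 : t (2 * v) = 0 → ky = 1 := fun h => by
      rw [ht] at h
      rw [hky, div_eq_one_iff_eq hHv.ne']
      linarith
    refine ⟨fun hS0 => ?_, fun hS0 => ?_, fun hS0 => ?_⟩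
    · have h0 := hneg hS0 v hv h1 h2 h3
      have h0' : G (2 * v) = 2 * v * a := by rw [hs] at h0; linarith
      refine ⟨hkx1 h0, (hG _).symm.trans h0', fun v' hv' h' => hsinj v' v hv' hv ?_, ?_⟩
      · rw [h0, hs, hG, h', sub_self]
      · rw [hky, h0', mul_sub, mul_comm b]
    · obtain rfl := hzero hS0 v hv h3
      exact ⟨rfl, hkx1 (by linarith), hky1 (by linarith)⟩
    · have h0 := hpos hS0 v hv h1 h2 h3
      have h0' : G (2 * v) = g (2 * v) * (2 * v - b) := by rw [ht] at h0; linarith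
      refine ⟨hky1 h0, (hG _).symm.trans h0', fun v' hv' h' => htinj v' v hv' hv ?_, ?_⟩
      · rw [h0, ht, hG, h', sub_self]
      · rw [hkx, h0']
end
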